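/- For a recurrent Markov chain on a countable state space, the maximum likelihood estimator of transition probabilities (empirical transition frequencies along an infinite trajectory) converges almost surely to the true transition probabilities: for every pair of states x, y, the fraction of visits to x that are immediately followed by y converges almost surely to P(x,y). -/

import Mathlib

open MeasureTheory Filter

namespace MCaux

variable {X : Type*}

/-- cylinder of length `n+1`. -/
def cyl (n : ℕ) (h : ℕ → X) : Set (ℕ → X) := {ω | ∀ i < n + 1, ω i = h i}

lemma cyl_congr {n : ℕ} {h g : ℕ → X} (hg : ∀ i < n + 1, h i = g i) : cyl n h = cyl n g := by
  ext ω
  simp only [cyl, Set.mem_ofPred_eq]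
  exact ⟨fun H i hi => (H i hi).trans (hg i hi), fun H i hi => (H i hi).trans (hg i hi).symm⟩

lemma cyl_inter {n m : ℕ} (hnm : n ≤ m) {h g : ℕ → X} (hne : (cyl n h ∩ cyl m g).Nonempty) :
    cyl n h ∩ cyl m g = cyl m g := by
  obtain ⟨ω, h1, h2⟩ := hne
  apply Set.inter_eq_right.2
  intro ω' h' i hi
  rw [h' i (by omega), ← h2 i (by omega), h1 i hi]

lemma isPi : IsPiSystem {s : Set (ℕ → X) | ∃ n h, s = cyl n h} := by
  rintro _ ⟨n, h, rfl⟩ _ ⟨m, g, rfl⟩ hne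
  rcases le_total n m with hnm | hnm
  · exact ⟨m, g, cyl_inter hnm hne⟩
  · rw [Set.inter_comm] at hne ⊢
    exact ⟨n, h, cyl_inter hnm hne⟩

variable [Countable X] [MeasurableSpace X] [MeasurableSingletonClass X]

lemma meas_dep {α : Type*} [MeasurableSpace α] (n : ℕ) (G : (ℕ → X) → α)
    (hG : ∀ ω ω' : ℕ → X, (∀ i < n + 1, ω i = ω' i) → G ω = G ω') :
    Measurable[(Filtration.piLE (X := fun _ : ℕ => X)) n] G := by
  classical
  by_cases hX : Nonempty X
  · let e : (∀ _ : Set.Iic n, X) → (ℕ → X) :=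
      fun v i => if h : i ≤ n then v ⟨i, h⟩ else Classical.arbitrary X
    have : G = (G ∘ e) ∘ (Preorder.restrictLe (π := fun _ : ℕ => X) n) := by
      funext ω
      apply hG
      intro i hi
      have : i ≤ n := by omega
      simp [e, this]
    rw [this]
    exact Measurable.comp (measurable_of_countable _) (comap_measurable _)
  · have : IsEmpty (ℕ → X) := ⟨fun f => hX ⟨f 0⟩⟩
    exact fun s _ => by
      rw [Set.eq_empty_of_isEmpty (G ⁻¹' s)]
      exact MeasurableSpace.measurableSet_empty _

lemma meas_dep' {α : Type*} [MeasurableSpace α] (n : ℕ) (G : (ℕ → X) → α)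
    (hG : ∀ ω ω' : ℕ → X, (∀ i < n + 1, ω i = ω' i) → G ω = G ω') : Measurable G :=
  (meas_dep n G hG).mono ((Filtration.piLE (X := fun _ : ℕ => X)).le n) le_rfl

lemma meas_cyl (n : ℕ) (h : ℕ → X) : MeasurableSet (cyl n h) := by
  have : Measurable (fun ω => ω ∈ cyl n h) := by
    refine meas_dep' n _ ?_
    intro ω ω' H
    simp only [cyl, Set.mem_ofPred_eq, eq_iff_iff]
    exact ⟨fun K i hi => (H i hi) ▸ (K i hi), fun K i hi => (H i hi).symm ▸ (K i hi)⟩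
  exact measurableSet_setOfPred.2 this

lemma gen : (MeasurableSpace.pi : MeasurableSpace (ℕ → X)) =
    MeasurableSpace.generateFrom {s : Set (ℕ → X) | ∃ n h, s = cyl n h} := by
  classical
  apply le_antisymm
  · refine iSup_le fun i => ?_
    rw [← measurable_iff_comap_le]
    refine @measurable_to_countable' _ _ _ _ (_) _ ?_
    intro a
    have : (fun b : ℕ → X => b i) ⁻¹' {a} =
        ⋃ v : {v : Fin (i + 1) → X // v (Fin.last i) = a},
          cyl i (fun j => if h : j < i + 1 then v.1 ⟨j, h⟩ else a) := by
      ext ω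
      simp only [Set.mem_preimage, Set.mem_singleton_iff, Set.mem_iUnion]
      constructor
      · intro h
        refine ⟨⟨fun j => ω j, by simpa using h⟩, ?_⟩
        intro j hj
        simp [hj]
      · rintro ⟨v, hv⟩
        have := hv i (by omega)
        rw [this]
        beta_reduce
        rw [dif_pos (show i < i + 1 by omega)]
        exact v.2
    rw [this]
    exact MeasurableSet.iUnion fun v => MeasurableSpace.measurableSet_generateFrom ⟨_, _, rfl⟩
  · apply MeasurableSpace.generateFrom_le
    rintro _ ⟨n, h, rfl⟩
    exact meas_cyl n h

/-- Markov property on a cylinder. -/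
lemma markov (P : X → X → NNReal)
    (x : X) (ν : Measure (ℕ → X)) [IsProbabilityMeasure ν] [DecidableEq X]
    (hνcyl : ∀ (n : ℕ) (h : ℕ → X),
      ν {ω | ∀ i < n + 1, ω i = h i} =
        (if h 0 = x then 1 else 0) *
          ∏ k ∈ Finset.range n, (P (h k) (h (k + 1)) : ENNReal))
    (lam : X → ENNReal) (μ : Measure (ℕ → X)) [IsProbabilityMeasure μ]
    (hμcyl : ∀ (n : ℕ) (h : ℕ → X),
      μ {ω | ∀ i < n + 1, ω i = h i} =
        lam (h 0) * ∏ k ∈ Finset.range n, (P (h k) (h (k + 1)) : ENNReal))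
    (n : ℕ) (h : ℕ → X) (hx : h n = x) :
    (μ.restrict (cyl n h)).map (fun ω i => ω (n + i)) = μ (cyl n h) • ν := by
  have hθ : Measurable (fun (ω : ℕ → X) (i : ℕ) => ω (n + i)) :=
    measurable_pi_lambda _ fun i => measurable_pi_apply _
  refine ext_of_generate_finite _ gen isPi ?_ ?_
  · rintro _ ⟨m, g, rfl⟩
    rw [Measure.map_apply hθ (meas_cyl m g), Measure.restrict_apply (hθ (meas_cyl m g)),
      Measure.smul_apply, smul_eq_mul]
    have hν' : ν (cyl m g) = _ := hνcyl m g
    rw [hν']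
    by_cases hg : g 0 = x
    · have hset : (fun (ω : ℕ → X) (i : ℕ) => ω (n + i)) ⁻¹' cyl m g ∩ cyl n h =
          cyl (n + m) (fun i => if i ≤ n then h i else g (i - n)) := by
        ext ω
        simp only [cyl, Set.mem_inter_iff, Set.mem_preimage, Set.mem_ofPred_eq]
        constructor
        · rintro ⟨h1, h2⟩ i hi
          split_ifs with hin
          · exact h2 i (by omega)
          · have := h1 (i - n) (by omega)
            rwa [show n + (i - n) = i by omega] at this
        · intro H
          refine ⟨fun i hi => ?_, fun i hi => ?_⟩
          · rw [H (n + i) (by omega)]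
            rcases Nat.eq_zero_or_pos i with rfl | hi0
            · simp [hx, hg]
            · rw [if_neg (by omega)]
              congr 1
              omega
          · rw [H i (by omega), if_pos (by omega)]
      rw [hset]
      have h1 := hμcyl (n + m) (fun i => if i ≤ n then h i else g (i - n))
      have h2 := hμcyl n h
      unfold cyl
      rw [h1, h2, Finset.prod_range_add, if_pos hg, one_mul, mul_assoc]
      simp only [Nat.zero_le, if_true]
      congr 2
      · apply Finset.prod_congr rfl
        intro k hk
        have := Finset.mem_range.1 hk
        rw [if_pos (by omega), if_pos (by omega)]
      · apply Finset.prod_congr rfl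
        intro k hk
        rw [if_neg (show ¬ n + k + 1 ≤ n by omega), show n + k + 1 - n = k + 1 by omega]
        rcases Nat.eq_zero_or_pos k with rfl | hk0
        · simp [hx, hg]
        · rw [if_neg (by omega), show n + k - n = k by omega]
    · rw [if_neg hg, zero_mul, mul_zero]
      convert measure_empty (μ := μ)
      ext ω
      simp only [Set.mem_inter_iff, Set.mem_preimage, Set.mem_empty_iff_false, iff_false]
      rintro ⟨h1, h2⟩
      apply hg
      have a := h1 0 (by omega)
      have b := h2 n (by omega)
      simp only [add_zero] at a
      rw [← a, b, hx]
  · rw [Measure.map_apply hθ MeasurableSet.univ]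
    simp

lemma recur [DecidableEq X] (P : X → X → NNReal)
    (ν : X → Measure (ℕ → X)) (hνprob : ∀ x, IsProbabilityMeasure (ν x))
    (hνcyl : ∀ (x : X) (n : ℕ) (h : ℕ → X),
      ν x {ω | ∀ i < n + 1, ω i = h i} =
        (if h 0 = x then 1 else 0) *
          ∏ k ∈ Finset.range n, (P (h k) (h (k + 1)) : ENNReal))
    (hrec : ∀ x, ∀ᵐ ω ∂ ν x, {n | ω n = x}.Infinite)
    (lam : X → ENNReal)
    (μ : Measure (ℕ → X)) (hμprob : IsProbabilityMeasure μ)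
    (hμcyl : ∀ (n : ℕ) (h : ℕ → X),
      μ {ω | ∀ i < n + 1, ω i = h i} =
        lam (h 0) * ∏ k ∈ Finset.range n, (P (h k) (h (k + 1)) : ENNReal)) :
    ∀ᵐ ω ∂ μ, ∀ n, {k | ω k = ω n}.Infinite := by
  rw [ae_all_iff]
  intro n
  have key : ∀ h : ℕ → X, ∀ᵐ ω ∂ μ, ω ∈ cyl n h → {k | ω k = ω n}.Infinite := by
    intro h
    rw [← ae_restrict_iff' (meas_cyl n h)]
    have hm := markov P (h n) (ν (h n)) (hνcyl _) lam μ hμcyl n h rfl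
    have h1 : ∀ᵐ ω ∂ (μ (cyl n h) • ν (h n)), {k | ω k = h n}.Infinite :=
      Measure.ae_smul_measure (hrec (h n)) _
    rw [← hm] at h1
    have hθ : Measurable (fun (ω : ℕ → X) (i : ℕ) => ω (n + i)) :=
      measurable_pi_lambda _ fun i => measurable_pi_apply _
    have h2 := ae_of_ae_map hθ.aemeasurable h1
    filter_upwards [h2, ae_restrict_mem (meas_cyl n h)] with ω h3 h4
    have e : ω n = h n := h4 n (by omega)
    rw [e]
    refine (h3.image (f := fun i => n + i) (fun a _ b _ hab => by simpa using hab)).mono ?_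
    rintro _ ⟨i, hi, rfl⟩
    exact hi
  have hX : Nonempty X := by
    have hu := (hμprob.measure_univ)
    by_contra hX
    have : IsEmpty (ℕ → X) := ⟨fun f => hX ⟨f 0⟩⟩
    rw [Set.eq_empty_of_isEmpty (Set.univ : Set (ℕ → X))] at hu
    simp at hu
  have key2 := (ae_all_iff (μ := μ)).2 fun v : Fin (n + 1) → X =>
    key (fun j => if h : j < n + 1 then v ⟨j, h⟩ else Classical.arbitrary X)
  filter_upwards [key2] with ω hω
  refine hω (fun j => ω j) ?_
  intro j hj
  simp [hj]

section
variable [DecidableEq X]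

/-- visit count -/
noncomputable def N (x : X) (n : ℕ) (ω : ℕ → X) : ℝ :=
  ∑ k ∈ Finset.range n, if ω k = x then 1 else 0

/-- centered increments -/
noncomputable def D (x y : X) (p : ℝ) (n : ℕ) (ω : ℕ → X) : ℝ :=
  if ω n = x then (if ω (n + 1) = y then 1 else 0) - p else 0

/-- martingale -/
noncomputable def M (x y : X) (p : ℝ) (n : ℕ) (ω : ℕ → X) : ℝ :=
  ∑ k ∈ Finset.range n, (N x (k + 1) ω)⁻¹ * D x y p k ω


lemma N_nonneg (x : X) (n : ℕ) (ω : ℕ → X) : 0 ≤ N x n ω :=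
  Finset.sum_nonneg fun i _ => by split_ifs <;> simp

lemma N_succ (x : X) (n : ℕ) (ω : ℕ → X) :
    N x (n + 1) ω = N x n ω + if ω n = x then 1 else 0 := Finset.sum_range_succ _ _

lemma M_succ (x y : X) (p : ℝ) (n : ℕ) (ω : ℕ → X) :
    M x y p (n + 1) ω = M x y p n ω + (N x (n + 1) ω)⁻¹ * D x y p n ω :=
  Finset.sum_range_succ _ _

lemma N_dep (x : X) (n : ℕ) (ω ω' : ℕ → X) (h : ∀ i < n, ω i = ω' i) : N x n ω = N x n ω' :=
  Finset.sum_congr rfl fun i hi => by rw [h i (Finset.mem_range.1 hi)]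

lemma M_dep (x y : X) (p : ℝ) (n : ℕ) (ω ω' : ℕ → X) (h : ∀ i < n + 1, ω i = ω' i) :
    M x y p n ω = M x y p n ω' :=
  Finset.sum_congr rfl fun i hi => by
    have := Finset.mem_range.1 hi
    rw [N_dep x (i + 1) ω ω' fun j hj => h j (by omega)]
    unfold D
    rw [h i (by omega), h (i + 1) (by omega)]

lemma D_dep (x y : X) (p : ℝ) (n : ℕ) (ω ω' : ℕ → X) (h : ∀ i < n + 1 + 1, ω i = ω' i) :
    D x y p n ω = D x y p n ω' := by
  unfold D
  rw [h n (by omega), h (n + 1) (by omega)]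

lemma D_le (x y : X) {p : ℝ} (h0 : 0 ≤ p) (h1 : p ≤ 1) (n : ℕ) (ω : ℕ → X) :
    |D x y p n ω| ≤ 1 := by
  unfold D
  split_ifs <;> rw [abs_le] <;> constructor <;> linarith

/-- either off-state (and the increment vanishes) or the count is at least one -/
lemma Ninv_le (x : X) (n : ℕ) (ω : ℕ → X) : (N x n ω)⁻¹ ≤ 1 := by
  unfold N
  rw [← Finset.natCast_card_filter]
  exact Nat.cast_inv_le_one _

lemma Ninv_abs (x : X) (n : ℕ) (ω : ℕ → X) : |(N x n ω)⁻¹| ≤ 1 := by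
  rw [abs_of_nonneg (inv_nonneg.2 (N_nonneg _ _ _))]
  exact Ninv_le _ _ _

lemma M_le (x y : X) {p : ℝ} (h0 : 0 ≤ p) (h1 : p ≤ 1) (n : ℕ) (ω : ℕ → X) :
    |M x y p n ω| ≤ n := by
  refine (Finset.abs_sum_le_sum_abs _ _).trans ?_
  refine (Finset.sum_le_card_nsmul _ _ 1 ?_).trans (by simp)
  intro k _
  rw [abs_mul]
  exact mul_le_one₀ (Ninv_abs _ _ _) (abs_nonneg _) (D_le x y h0 h1 k ω)

lemma sq_le (x y : X) {p : ℝ} (h0 : 0 ≤ p) (h1 : p ≤ 1) (n : ℕ) (ω : ℕ → X) :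
    ∑ k ∈ Finset.range n, ((N x (k + 1) ω)⁻¹ * D x y p k ω) ^ 2 ≤ 2 - 2 / (N x n ω + 1) := by
  induction n with
  | zero => simp [N]
  | succ n ih =>
    rw [Finset.sum_range_succ]
    by_cases h : ω n = x
    · have hN : N x (n + 1) ω = N x n ω + 1 := by rw [N_succ, if_pos h]
      have hpos := N_nonneg x n ω
      have hD : D x y p n ω ^ 2 ≤ 1 := by
        rw [← sq_abs]; exact pow_le_one₀ (abs_nonneg _) (D_le x y h0 h1 n ω)
      rw [hN, mul_pow]
      set m := N x n ω
      have h3 : ((m + 1)⁻¹) ^ 2 * D x y p n ω ^ 2 ≤ ((m + 1)⁻¹) ^ 2 :=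
        mul_le_of_le_one_right (by positivity) hD
      have h4 : ((m + 1)⁻¹) ^ 2 ≤ 2 / (m + 1) - 2 / (m + 1 + 1) := by
        rw [div_sub_div _ _ (by positivity) (by positivity), inv_pow, inv_eq_one_div,
          div_le_div_iff₀ (by positivity) (by positivity)]
        nlinarith [mul_nonneg hpos hpos, mul_nonneg hpos (mul_nonneg hpos hpos)]
      linarith
    · have hN : N x (n + 1) ω = N x n ω := by rw [N_succ, if_neg h, add_zero]
      rw [hN]
      simpa [D, h] using ih

lemma abel (x y : X) (p L : ℝ) (n : ℕ) (ω : ℕ → X) :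
    ∑ k ∈ Finset.range n, D x y p k ω =
      N x n ω * (M x y p n ω - L) -
        ∑ k ∈ Finset.range n, (if ω k = x then 1 else 0) * (M x y p k ω - L) := by
  induction n with
  | zero => simp [N]
  | succ n ih =>
    rw [Finset.sum_range_succ, Finset.sum_range_succ, ih, M_succ]
    have : N x (n + 1) ω * ((N x (n + 1) ω)⁻¹ * D x y p n ω) = D x y p n ω := by
      by_cases h : ω n = x
      · have hN : N x (n + 1) ω = N x n ω + 1 := by rw [N_succ, if_pos h]
        have := N_nonneg x n ω
        rw [mul_inv_cancel_left₀]
        rw [hN]; positivity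
      · simp [D, h]
    have h2 := N_succ x n ω
    generalize (if ω n = x then (1 : ℝ) else 0) = q at *
    have : N x (n + 1) ω * (M x y p n ω + (N x (n + 1) ω)⁻¹ * D x y p n ω - L) =
      N x (n + 1) ω * (M x y p n ω - L) + D x y p n ω := by
        linear_combination this
    rw [this, h2]
    ring

lemma N_tendsto (x : X) (ω : ℕ → X) (h : {k | ω k = x}.Infinite) :
    Tendsto (fun n => N x n ω) atTop atTop := by
  have hmono : Monotone fun n => N x n ω := by
    refine monotone_nat_of_le_succ fun n => ?_
    rw [N_succ]; split_ifs <;> simp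
  refine tendsto_atTop_atTop_of_monotone hmono fun b => ?_
  obtain ⟨m, hm⟩ := exists_nat_ge b
  obtain ⟨t, ht, hc⟩ := h.exists_subset_card_eq m
  obtain ⟨n, hn⟩ := t.exists_nat_subset_range
  refine ⟨n, hm.trans ?_⟩
  unfold N
  rw [← Finset.natCast_card_filter, ← hc]
  exact_mod_cast Finset.card_le_card fun k hk => Finset.mem_filter.2 ⟨hn hk, ht hk⟩

lemma determ (x y : X) (p : ℝ) (ω : ℕ → X) (h : {k | ω k = x}.Infinite) (L : ℝ)
    (hL : Tendsto (fun n => M x y p n ω) atTop (nhds L)) :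
    Tendsto (fun n =>
          (((Finset.range n).filter (fun k => ω k = x ∧ ω (k + 1) = y)).card : ℝ) /
            (((Finset.range n).filter (fun k => ω k = x)).card : ℝ))
        atTop (nhds p) := by
  have hN := N_tendsto x ω h
  have hL0 : Tendsto (fun n => M x y p n ω - L) atTop (nhds 0) := by
    simpa using hL.sub_const L
  have h1 : (fun n => (if ω n = x then (1 : ℝ) else 0) * (M x y p n ω - L))
      =o[atTop] fun n => (if ω n = x then (1 : ℝ) else 0) := by
    have := (Asymptotics.isBigO_refl (fun n => (if ω n = x then (1 : ℝ) else 0))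
      atTop).mul_isLittleO ((Asymptotics.isLittleO_one_iff ℝ).2 hL0)
    simpa using this
  have h2 := h1.sum_range (fun n => by simp only [Pi.zero_apply]; split_ifs <;> simp) hN
  have h3 := h2.tendsto_div_nhds_zero
  have h4 := (hL0.sub h3).add_const p
  simp only [sub_zero, zero_add] at h4
  refine h4.congr' ?_
  filter_upwards [hN.eventually_gt_atTop 0] with n hn
  rw [Finset.natCast_card_filter, Finset.natCast_card_filter]
  change _ = _ / N x n ω
  change _ - _ / N x n ω + p = _
  have hs : ∑ k ∈ Finset.range n, (if ω k = x ∧ ω (k + 1) = y then (1 : ℝ) else 0) =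
      ∑ k ∈ Finset.range n, D x y p k ω + p * N x n ω := by
    unfold N
    rw [Finset.mul_sum, ← Finset.sum_add_distrib]
    refine Finset.sum_congr rfl fun k _ => ?_
    unfold D
    by_cases a : ω k = x <;> by_cases b : ω (k + 1) = y <;> simp [a, b]
  rw [hs, abel x y p L]
  field_simp

end

section
variable [DecidableEq X]

lemma integrable_dep (μ : Measure (ℕ → X)) [IsProbabilityMeasure μ] (n : ℕ) (G : (ℕ → X) → ℝ)
    (hG : ∀ ω ω' : ℕ → X, (∀ i < n + 1, ω i = ω' i) → G ω = G ω') (C : ℝ)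
    (hC : ∀ ω, |G ω| ≤ C) : Integrable G μ :=
  Integrable.of_bound (meas_dep' n G hG).aestronglyMeasurable C (ae_of_all _ hC)

lemma key (P : X → X → NNReal) (hP : ∀ x y, P x y ≤ 1) (lam : X → ENNReal)
    (μ : Measure (ℕ → X)) [IsProbabilityMeasure μ]
    (hμcyl : ∀ (n : ℕ) (h : ℕ → X),
      μ {ω | ∀ i < n + 1, ω i = h i} =
        lam (h 0) * ∏ k ∈ Finset.range n, (P (h k) (h (k + 1)) : ENNReal))
    (x y : X) (n : ℕ) (G : (ℕ → X) → ℝ)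
    (hG : ∀ ω ω' : ℕ → X, (∀ i < n + 1, ω i = ω' i) → G ω = G ω') (C : ℝ)
    (hC : ∀ ω, |G ω| ≤ C) :
    ∫ ω, G ω * D x y (P x y) n ω ∂μ = 0 := by
  have hint : Integrable (fun ω => G ω * D x y (P x y) n ω) μ := by
    refine integrable_dep μ (n + 1) _ ?_ C ?_
    · intro ω ω' h
      rw [hG ω ω' fun i hi => h i (by omega), D_dep x y _ n ω ω' h]
    · intro ω
      rw [abs_mul]
      have a := D_le x y (p := P x y) (P x y).2 (by exact_mod_cast hP x y) n ω
      have b := hC ω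
      nlinarith [abs_nonneg (G ω), abs_nonneg (D x y (P x y) n ω)]
  let r : (ℕ → X) → (Fin (n + 1) → X) := fun ω i => ω i
  have hr : Measurable r := measurable_pi_lambda _ fun i => measurable_pi_apply _
  have hU : (⋃ v, r ⁻¹' {v}) = Set.univ := by
    ext ω; simp
  rw [← setIntegral_univ, ← hU, integral_iUnion (fun v => hr (measurableSet_singleton v))
    (fun a b hab => by
      rw [Function.onFun, Set.disjoint_left]
      rintro ω rfl h2
      exact hab h2) hint.integrableOn]
  convert tsum_zero with v
  rcases (r ⁻¹' {v}).eq_empty_or_nonempty with he | ⟨h, hh⟩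
  · rw [he]; simp
  have hc : r ⁻¹' {v} = cyl n h := by
    ext ω
    have : r h = v := hh
    simp only [Set.mem_preimage, ← this, Set.mem_singleton_iff, cyl, Set.mem_ofPred_eq]
    constructor
    · intro H i hi
      exact congrFun H ⟨i, hi⟩
    · intro H
      funext i
      exact H i i.2
  rw [hc]
  by_cases hx : h n = x
  · let h' : ℕ → X := fun i => if i ≤ n then h i else y
    have hB : cyl n h ∩ {ω | ω (n + 1) = y} = cyl (n + 1) h' := by
      ext ω
      simp only [cyl, Set.mem_inter_iff, Set.mem_ofPred_eq, h']
      constructor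
      · rintro ⟨a, b⟩ i hi
        split_ifs with hin
        · exact a i (by omega)
        · rw [← b]; congr 1; omega
      · intro H
        refine ⟨fun i hi => ?_, ?_⟩
        · rw [H i (by omega), if_pos (by omega)]
        · rw [H _ (by omega), if_neg (by omega)]
    have hmB : MeasurableSet {ω : ℕ → X | ω (n + 1) = y} :=
      (measurable_pi_apply (X := fun _ : ℕ => X) (n + 1)) (measurableSet_singleton y)
    have hval : μ.real (cyl (n + 1) h') = μ.real (cyl n h) * P x y := by
      have a : μ (cyl (n + 1) h') = μ (cyl n h) * P x y := by
        unfold cyl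
        rw [hμcyl, hμcyl, Finset.prod_range_succ, ← mul_assoc]
        congr 2
        · apply Finset.prod_congr rfl
          intro k hk
          have := Finset.mem_range.1 hk
          simp only [h']
          rw [if_pos (by omega), if_pos (by omega)]
        · simp [h', hx]
      rw [Measure.real, a, ENNReal.toReal_mul]
      rfl
    have e : ∫ ω in cyl n h, G ω * D x y (P x y) n ω ∂μ =
        ∫ ω in cyl n h, G h * ({ω : ℕ → X | ω (n + 1) = y}.indicator (fun _ => (1 : ℝ)) ω
          - P x y) ∂μ := by
      refine setIntegral_congr_fun (meas_cyl n h) fun ω hω => ?_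
      have a : ω n = x := (hω n (by omega)).trans hx
      simp only [hG ω h hω, D, a, if_true, Set.indicator, Set.mem_ofPred_eq]
    rw [e, integral_const_mul, integral_sub, integral_indicator hmB]
    · simp only [setIntegral_const, integral_const, smul_eq_mul, mul_one, measureReal_restrict_apply_univ,
        measureReal_restrict_apply hmB, Measure.restrict_restrict hmB]
      rw [Set.inter_comm, hB, hval]
      ring
    · exact (integrable_const _).indicator hmB
    · exact integrable_const _
  · rw [setIntegral_congr_fun (g := fun _ => (0 : ℝ)) (meas_cyl n h)]
    · simp
    · intro ω hω
      have a : ω n ≠ x := fun H => hx ((hω n (by omega)).symm.trans H)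
      simp [D, a]

lemma conv (P : X → X → NNReal) (hP : ∀ x y, P x y ≤ 1) (lam : X → ENNReal)
    (μ : Measure (ℕ → X)) [IsProbabilityMeasure μ]
    (hμcyl : ∀ (n : ℕ) (h : ℕ → X),
      μ {ω | ∀ i < n + 1, ω i = h i} =
        lam (h 0) * ∏ k ∈ Finset.range n, (P (h k) (h (k + 1)) : ENNReal))
    (x y : X) : ∀ᵐ ω ∂μ, ∃ L, Tendsto (fun n => M x y (P x y) n ω) atTop (nhds L) := by
  have hp0 : (0 : ℝ) ≤ P x y := (P x y).2
  have hp1 : (P x y : ℝ) ≤ 1 := by exact_mod_cast hP x y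
  have hMint : ∀ n, Integrable (M x y (P x y) n) μ := fun n =>
    integrable_dep μ n _ (M_dep x y _ n) n (M_le x y hp0 hp1 n)
  have hstep : ∀ n, ∀ ω ω' : ℕ → X, (∀ i < n + 1 + 1, ω i = ω' i) →
      (N x (n + 1) ω)⁻¹ * D x y (P x y) n ω = (N x (n + 1) ω')⁻¹ * D x y (P x y) n ω' := by
    intro n ω ω' h
    rw [D_dep x y _ n ω ω' h, N_dep x (n + 1) ω ω' fun i hi => h i (by omega)]
  have hstep_le : ∀ n ω, |(N x (n + 1) ω)⁻¹ * D x y (P x y) n ω| ≤ 1 := by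
    intro n ω
    rw [abs_mul]
    exact mul_le_one₀ (Ninv_abs _ _ _) (abs_nonneg _) (D_le x y hp0 hp1 n ω)
  have hstepint : ∀ n, Integrable (fun ω => (N x (n + 1) ω)⁻¹ * D x y (P x y) n ω) μ := fun n =>
    integrable_dep μ (n + 1) _ (hstep n) 1 (hstep_le n)
  have hmart : Martingale (M x y (P x y)) (Filtration.piLE (X := fun _ : ℕ => X)) μ := by
    refine martingale_of_setIntegral_eq_succ ?_ hMint ?_
    · intro n
      exact (meas_dep n _ (M_dep x y _ n)).stronglyMeasurable
    · intro n s hs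
      have hs' : MeasurableSet s := (Filtration.piLE (X := fun _ : ℕ => X)).le n s hs
      simp_rw [M_succ]
      rw [integral_add (hMint n).integrableOn (hstepint n).integrableOn]
      rw [left_eq_add, ← integral_indicator hs']
      have := key P hP lam μ hμcyl x y n
        (fun ω => s.indicator (fun ω => (N x (n + 1) ω)⁻¹) ω) ?_ 1 ?_
      · rw [← this]
        congr 1
        funext ω
        by_cases h : ω ∈ s <;> simp [h]
      · intro ω ω' h
        obtain ⟨t, ht, rfl⟩ := hs
        have e : Preorder.restrictLe (π := fun _ : ℕ => X) n ω =
            Preorder.restrictLe (π := fun _ : ℕ => X) n ω' := by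
          funext i
          exact h i (Nat.lt_succ_of_le i.2)
        have e2 : ω ∈ Preorder.restrictLe (π := fun _ : ℕ => X) n ⁻¹' t ↔
            ω' ∈ Preorder.restrictLe (π := fun _ : ℕ => X) n ⁻¹' t := by
          rw [Set.mem_preimage, Set.mem_preimage, e]
        simp only [Set.indicator, N_dep x (n + 1) ω ω' h]
        by_cases ho : ω ∈ Preorder.restrictLe (π := fun _ : ℕ => X) n ⁻¹' t
        · rw [if_pos ho, if_pos (e2.1 ho)]
        · rw [if_neg ho, if_neg fun H => ho (e2.2 H)]
      · intro ω
        by_cases h : ω ∈ s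
        · simpa [h] using Ninv_abs x (n + 1) ω
        · simp [h]
  have hMsq : ∀ n, Integrable (fun ω => M x y (P x y) n ω ^ 2) μ := fun n =>
    integrable_dep μ n _ (fun ω ω' h => by rw [M_dep x y _ n ω ω' h]) ((n : ℝ) ^ 2) (fun ω => by
      rw [abs_pow]
      exact pow_le_pow_left₀ (abs_nonneg _) (M_le x y hp0 hp1 n ω) 2)
  have hssq : ∀ n, Integrable (fun ω => ((N x (n + 1) ω)⁻¹ * D x y (P x y) n ω) ^ 2) μ := fun n =>
    integrable_dep μ (n + 1) _ (fun ω ω' h => by rw [hstep n ω ω' h]) 1 (fun ω => by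
      rw [abs_pow]
      exact pow_le_one₀ (abs_nonneg _) (hstep_le n ω))
  have hcross : ∀ n, Integrable (fun ω => (2 * M x y (P x y) n ω * (N x (n + 1) ω)⁻¹) *
      D x y (P x y) n ω) μ ∧ ∫ ω, (2 * M x y (P x y) n ω * (N x (n + 1) ω)⁻¹) *
      D x y (P x y) n ω ∂μ = 0 := by
    intro n
    have hb : ∀ ω, |2 * M x y (P x y) n ω * (N x (n + 1) ω)⁻¹| ≤ 2 * n := by
      intro ω
      rw [abs_mul, abs_mul, abs_two]
      have a := M_le x y hp0 hp1 n ω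
      have b := Ninv_abs x (n + 1) ω
      have := abs_nonneg (M x y (P x y) n ω)
      nlinarith
    have hd : ∀ ω ω' : ℕ → X, (∀ i < n + 1, ω i = ω' i) →
      2 * M x y (P x y) n ω * (N x (n + 1) ω)⁻¹ = 2 * M x y (P x y) n ω' * (N x (n + 1) ω')⁻¹ := by
      intro ω ω' h
      rw [M_dep x y _ n ω ω' h, N_dep x (n + 1) ω ω' h]
    refine ⟨integrable_dep μ (n + 1) _ ?_ (2 * n) ?_, key P hP lam μ hμcyl x y n _ hd _ hb⟩
    · intro ω ω' h
      rw [hd ω ω' fun i hi => h i (by omega), D_dep x y _ n ω ω' h]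
    · intro ω
      rw [abs_mul]
      exact (mul_le_of_le_one_right (abs_nonneg _) (D_le x y hp0 hp1 n ω)).trans (hb ω)
  have hE : ∀ n, ∫ ω, M x y (P x y) n ω ^ 2 ∂μ =
      ∫ ω, ∑ k ∈ Finset.range n, ((N x (k + 1) ω)⁻¹ * D x y (P x y) k ω) ^ 2 ∂μ := by
    intro n
    induction n with
    | zero => simp [M]
    | succ n ih =>
      simp_rw [Finset.sum_range_succ]
      rw [integral_add (integrable_finsetSum _ fun k _ => hssq k) (hssq n), ← ih]
      have : ∀ ω, M x y (P x y) (n + 1) ω ^ 2 = M x y (P x y) n ω ^ 2 +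
          (2 * M x y (P x y) n ω * (N x (n + 1) ω)⁻¹) * D x y (P x y) n ω +
          ((N x (n + 1) ω)⁻¹ * D x y (P x y) n ω) ^ 2 := by
        intro ω; rw [M_succ]; ring
      simp_rw [this]
      have hadd : Integrable (fun ω => M x y (P x y) n ω ^ 2 +
          (2 * M x y (P x y) n ω * (N x (n + 1) ω)⁻¹) * D x y (P x y) n ω) μ :=
        (hMsq n).add (hcross n).1
      rw [integral_add hadd (hssq n), integral_add (hMsq n) (hcross n).1,
        (hcross n).2, add_zero]
  have hE2 : ∀ n, ∫ ω, M x y (P x y) n ω ^ 2 ∂μ ≤ 2 := by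
    intro n
    rw [hE]
    refine (integral_mono (integrable_finsetSum _ fun k _ => hssq k) (integrable_const (2 : ℝ))
      fun ω => ?_).trans (by simp)
    have := sq_le x y hp0 hp1 n ω
    have h2 : 0 ≤ 2 / (N x n ω + 1) := by
      have := N_nonneg x n ω
      positivity
    simp only
    linarith
  refine hmart.submartingale.exists_ae_tendsto_of_bdd (R := 3) fun n => ?_
  rw [eLpNorm_one_eq_lintegral_enorm, ← ofReal_integral_norm_eq_lintegral_enorm (hMint n)]
  have : ∫ ω, ‖M x y (P x y) n ω‖ ∂μ ≤ 3 := by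
    have a : ∫ ω, ‖M x y (P x y) n ω‖ ∂μ ≤ ∫ ω, (1 + M x y (P x y) n ω ^ 2) ∂μ := by
      refine integral_mono (hMint n).norm ((integrable_const _).add (hMsq n)) fun ω => ?_
      simp only [Real.norm_eq_abs]
      rw [← sq_abs]
      nlinarith [sq_nonneg (|M x y (P x y) n ω| - 1), abs_nonneg (M x y (P x y) n ω)]
    rw [integral_add (integrable_const _) (hMsq n)] at a
    simp only [integral_const, probReal_univ, smul_eq_mul, mul_one] at a
    linarith [hE2 n]
  calc ENNReal.ofReal _ ≤ ENNReal.ofReal 3 := ENNReal.ofReal_le_ofReal this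
    _ = _ := by simp

end

end MCaux


/-- For a recurrent Markov chain on a countable state space, the empirical transition
frequencies along an infinite trajectory converge almost surely to the true transition
probabilities. -/
theorem stmt0 {X : Type*} [Countable X] [DecidableEq X] [MeasurableSpace X]
    [MeasurableSingletonClass X]
    (P : X → X → NNReal) (hProw : ∀ x, ∑' y, P x y = 1)
    -- chain measures started from each state x (deterministic start at x)
    (ν : X → Measure (ℕ → X)) (hνprob : ∀ x, IsProbabilityMeasure (ν x))
    (hνcyl : ∀ (x : X) (n : ℕ) (h : ℕ → X),
      ν x {ω | ∀ i < n + 1, ω i = h i} =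
        (if h 0 = x then 1 else 0) *
          ∏ k ∈ Finset.range n, (P (h k) (h (k + 1)) : ENNReal))
    -- recurrence: the chain started at x visits x infinitely often a.s.
    (hrec : ∀ x, ∀ᵐ ω ∂ ν x, {n | ω n = x}.Infinite)
    -- chain measure started from an arbitrary initial distribution lam
    (lam : X → ENNReal) (hlam : ∑' x, lam x = 1)
    (μ : Measure (ℕ → X)) (hμprob : IsProbabilityMeasure μ)
    (hμcyl : ∀ (n : ℕ) (h : ℕ → X),
      μ {ω | ∀ i < n + 1, ω i = h i} =
        lam (h 0) * ∏ k ∈ Finset.range n, (P (h k) (h (k + 1)) : ENNReal)) :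
    ∀ᵐ ω ∂ μ, ∀ x y : X, (∃ n, ω n = x) →
      Tendsto (fun n =>
          (((Finset.range n).filter (fun k => ω k = x ∧ ω (k + 1) = y)).card : ℝ) /
            (((Finset.range n).filter (fun k => ω k = x)).card : ℝ))
        atTop (nhds (P x y : ℝ)) := by
  have hP : ∀ x y, P x y ≤ 1 := by
    intro x y
    have hs : Summable (P x) := by
      by_contra hn
      have := hProw x
      rw [tsum_eq_zero_of_not_summable hn] at this
      exact zero_ne_one this
    rw [← hProw x]
    exact hs.le_tsum y fun _ _ => zero_le
  have h1 := MCaux.recur P ν hνprob hνcyl hrec lam μ hμprob hμcyl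
  have h2 : ∀ᵐ ω ∂μ, ∀ x y : X, ∃ L, Tendsto (fun n => MCaux.M x y (P x y) n ω) atTop (nhds L) := by
    rw [ae_all_iff]
    intro x
    rw [ae_all_iff]
    intro y
    exact MCaux.conv P hP lam μ hμcyl x y
  filter_upwards [h1, h2] with ω a b x y hx
  obtain ⟨n, rfl⟩ := hx
  obtain ⟨L, hL⟩ := b (ω n) y
  exact MCaux.determ (ω n) y _ ω (a n) L hL
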